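/- arXiv:1404.3384 — 4 statements merged into one kernel-verified Lean document; each statement's English description precedes it below -/
import Mathlib

section
/- Let r be a positive integer and let S be a homogeneous family of finite nonempty subsets of the positive integers which is r-regular. Then for every coloring c : ℕ⁺ → Fin r of the positive integers with r colors, there exist a set B ∈ S and positive integers d and M such that all the integers b + λd, where b ∈ B and λ is an integer with |λ| ≤ M, are positive and receive the same color under c. -/
/-- Compactness: if every `κ`-coloring makes some member of `S` monochromatic, then already the
members of `S` inside some initial segment suffice. -/
theorem exists_bound_of_regular {κ : Type*} [Finite κ] {S : Set (Finset ℕ)}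
    (hreg : ∀ c : ℕ → κ, ∃ A ∈ S, ∀ a ∈ A, ∀ b ∈ A, c a = c b) :
    ∃ N : ℕ, ∀ c : ℕ → κ, ∃ A ∈ S, (∀ a ∈ A, a ≤ N) ∧ ∀ a ∈ A, ∀ b ∈ A, c a = c b := by
  by_contra! hbad
  choose f hf using hbad
  have hlim (n : ℕ) : ∃ k, ∀ᶠ N in (Filter.hyperfilter ℕ : Filter ℕ), f N n = k := by
    have h : ∀ᶠ N in (Filter.hyperfilter ℕ : Filter ℕ), ∃ k, f N n = k := by simp
    exact Ultrafilter.eventually_exists_iff.mp h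
  choose g hg using hlim
  obtain ⟨A, hAS, hA⟩ := hreg g
  have hagree : ∀ᶠ N in (Filter.hyperfilter ℕ : Filter ℕ), ∀ a ∈ A, f N a = g a :=
    (Filter.eventually_all_finset A).mpr fun a _ => hg a
  have hlarge : ∀ᶠ N in (Filter.hyperfilter ℕ : Filter ℕ), A.sup id ≤ N :=
    Nat.hyperfilter_le_atTop (Filter.eventually_ge_atTop _)
  obtain ⟨N, hN, hle⟩ := (hagree.and hlarge).exists
  obtain ⟨a, ha, b, hb, hne⟩ := hf N A hAS fun a ha => (Finset.le_sup (f := id) ha).trans hle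
  exact hne (by rw [hN a ha, hN b hb, hA a ha b hb])

/-- A simultaneous van der Waerden theorem: around some `x` there is a progression of length
`2 * K + 1` whose dilations by each `i ≤ N` are all monochromatic. -/
theorem exists_progression_dilates_monochromatic {κ : Type*} [Finite κ] (c : ℕ → κ) (N K : ℕ) :
    ∃ x e : ℕ, 0 < e ∧ K * e < x ∧ ∀ i ≤ N, ∀ μ : ℤ, |μ| ≤ K →
      c ((i : ℤ) * (x + μ * e)).toNat = c (i * x) := by
  obtain ⟨e, he, y, k, hk⟩ := Combinatorics.exists_mono_homothetic_copy
    (Finset.range (2 * K + 2)) fun n : ℕ => fun i : Fin (N + 1) => c (i * n)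
  refine ⟨e * (K + 1) + y, e, he, by nlinarith, fun i hi μ hμ => ?_⟩
  obtain ⟨hμ₁, hμ₂⟩ := abs_le.mp hμ
  obtain ⟨s, hs⟩ := Int.eq_ofNat_of_zero_le (show 0 ≤ (K : ℤ) + 1 + μ by lia)
  have h₁ := congrFun (hk s (Finset.mem_range.mpr (by lia))) ⟨i, by lia⟩
  have h₂ := congrFun (hk (K + 1) (Finset.mem_range.mpr (by lia))) ⟨i, by lia⟩
  simp only [smul_eq_mul] at h₁ h₂
  rw [h₂, ← h₁]
  congr 1
  have : (i : ℤ) * ((e * (K + 1) + y : ℕ) + μ * e) = ((i * (e * s + y) : ℕ) : ℤ) := by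
    push_cast
    rw [← hs]
    ring
  rw [this, Int.toNat_natCast]


/-- Lemma 2.1: if `S` is a homogeneous `r`-regular family of finite nonempty sets
of positive integers, then for any `r`-coloring there are `B ∈ S` and `d, M > 0`
such that all `b + λ d` with `b ∈ B`, `|λ| ≤ M` are positive and the same color. -/
theorem monochromatic_progressions_around_set
    (r : ℕ) (hr : 0 < r) (S : Set (Finset ℕ))
    (hS : ∀ A ∈ S, A.Nonempty ∧ ∀ a ∈ A, 0 < a)
    (hhom : ∀ A ∈ S, ∀ k : ℕ, 0 < k → A.image (fun a => k * a) ∈ S)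
    (hreg : ∀ c : ℕ → Fin r, ∃ A ∈ S, ∀ a ∈ A, ∀ b ∈ A, c a = c b)
    (c : ℕ → Fin r) :
    ∃ B ∈ S, ∃ d M : ℕ, 0 < d ∧ 0 < M ∧
      (∀ b ∈ B, ∀ lam : ℤ, |lam| ≤ (M : ℤ) → 0 < (b : ℤ) + lam * (d : ℤ)) ∧
      (∀ b ∈ B, ∀ lam : ℤ, |lam| ≤ (M : ℤ) →
        ∀ b' ∈ B, ∀ lam' : ℤ, |lam'| ≤ (M : ℤ) →
          c ((b : ℤ) + lam * (d : ℤ)).toNat = c ((b' : ℤ) + lam' * (d : ℤ)).toNat) := by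
  obtain ⟨N, hN⟩ := exists_bound_of_regular hreg
  obtain ⟨x, e, he, hx, hc⟩ := exists_progression_dilates_monochromatic c N N.factorial
  obtain ⟨A, hAS, hAN, hA⟩ := hN fun i => c (i * x)
  have hx0 : 0 < x := Nat.zero_lt_of_lt hx
  have key : ∀ b ∈ A.image (fun a => x * a), ∀ lam : ℤ, |lam| ≤ ((1 : ℕ) : ℤ) →
      0 < (b : ℤ) + lam * ((N.factorial * e : ℕ) : ℤ) ∧
        c ((b : ℤ) + lam * ((N.factorial * e : ℕ) : ℤ)).toNat = c b := by
    intro b hb lam hlam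
    obtain ⟨i, hi, rfl⟩ := Finset.mem_image.mp hb
    have hi0 : 0 < i := (hS A hAS).2 i hi
    obtain ⟨q, hq⟩ := Nat.dvd_factorial hi0 (hAN i hi)
    have hqle : q ≤ N.factorial := hq ▸ Nat.le_mul_of_pos_left q hi0
    have hμ : |lam * q| ≤ (N.factorial : ℤ) := by
      rw [abs_mul, Nat.abs_cast]
      push_cast at hlam
      have : (q : ℤ) ≤ N.factorial := by exact_mod_cast hqle
      nlinarith
    have heq : ((x * i : ℕ) : ℤ) + lam * ((N.factorial * e : ℕ) : ℤ) =
        (i : ℤ) * (x + (lam * q) * e) := by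
      rw [hq]
      push_cast
      ring
    rw [heq]
    refine ⟨mul_pos (by exact_mod_cast hi0) ?_, (hc i (hAN i hi) _ hμ).trans (by rw [mul_comm])⟩
    have h₁ : -(N.factorial : ℤ) * e ≤ lam * q * e :=
      mul_le_mul_of_nonneg_right (abs_le.mp hμ).1 (by positivity)
    have h₂ : (N.factorial : ℤ) * e < x := by exact_mod_cast hx
    linarith
  refine ⟨A.image (fun a => x * a), hhom A hAS x hx0, N.factorial * e, 1,
    Nat.mul_pos N.factorial_pos he, one_pos, fun b hb lam hlam => (key b hb lam hlam).1,
    fun b hb lam hlam b' hb' lam' hlam' => ?_⟩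
  rw [(key b hb lam hlam).2, (key b' hb' lam' hlam').2]
  obtain ⟨i, hi, rfl⟩ := Finset.mem_image.mp hb
  obtain ⟨j, hj, rfl⟩ := Finset.mem_image.mp hb'
  simpa only [mul_comm x] using hA i hi j hj
end

section
/- Let r be a positive integer and let S be a homogeneous family of finite nonempty subsets of the positive integers which is r-regular. Let q and M be positive integers. Then for every coloring c : ℕ⁺ → Fin r of the positive integers with r colors, there exist a set B ∈ S and a positive integer d such that all the integers b + λd, where b ∈ B and λ is an integer with |λ| ≤ M, are positive and receive the same color under c, and moreover the integer q·d also receives that same color. -/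
/-- Compactness of the space of colorings: a property which every coloring acquires on some initial
segment is acquired by all colorings on a common initial segment. -/
theorem exists_uniform_of_forall_coloring {κ : Type*} [Finite κ] (Q : ℕ → (ℕ → κ) → Prop)
    (hmono : ∀ c, Monotone fun N => Q N c)
    (hloc : ∀ N c c', (∀ n ≤ N, c n = c' n) → Q N c → Q N c')
    (hQ : ∀ c, ∃ N, Q N c) : ∃ N, ∀ c, Q N c := by
  let _ : TopologicalSpace κ := ⊥
  have : DiscreteTopology κ := ⟨rfl⟩
  have hopen : ∀ N, IsOpen {c | Q N c} := by
    intro N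
    rw [isOpen_iff_forall_mem_open]
    intro c hc
    refine ⟨(Set.Iic N).pi fun n => {c n}, fun c' hc' => ?_, ?_, fun n _ => rfl⟩
    · exact hloc N c c' (fun n hn => (hc' n hn).symm) hc
    · exact isOpen_set_pi (Set.finite_Iic N) fun n _ => isOpen_discrete _
  obtain ⟨N, hN⟩ := isCompact_univ.elim_directed_cover (fun N => {c | Q N c}) hopen
    (fun c _ => Set.mem_iUnion.2 (hQ c))
    (Monotone.directed_le fun _ _ h c hc => hmono c h hc)
  exact ⟨N, fun c => hN (Set.mem_univ c)⟩

/-- A finite form of van der Waerden's theorem for finitely many dilates at once: the progression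
`x + μ e` with `|μ| ≤ L` is positive and its dilates by each `a ≤ N` are monochromatic. -/
theorem exists_mono_dilated_progressions {κ : Type*} [Finite κ] (c : ℕ → κ) (N L : ℕ) :
    ∃ x e : ℕ, 0 < e ∧ L * e < x ∧ ∀ a ≤ N, ∀ y : ℕ, ∀ μ : ℤ, |μ| ≤ L →
      (y : ℤ) = x + μ * e → c (a * y) = c (a * x) := by
  obtain ⟨e, he, b, v, hv⟩ := Combinatorics.exists_mono_homothetic_copy
    (Finset.range (2 * L + 2)) fun n => fun j : Fin (N + 1) => c (j * n)
  have key : ∀ s < 2 * L + 2, ∀ a, (ha : a ≤ N) → c (a * (e * s + b)) = v ⟨a, by omega⟩ := by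
    intro s hs a ha
    exact congrFun (hv s (Finset.mem_range.2 hs)) ⟨a, by omega⟩
  refine ⟨e * (L + 1) + b, e, he, by nlinarith, fun a ha y μ hμ hy => ?_⟩
  obtain ⟨h₁, h₂⟩ := abs_le.1 hμ
  obtain ⟨s, hs⟩ := Int.eq_ofNat_of_zero_le (show 0 ≤ (L : ℤ) + 1 + μ by omega)
  have hys : y = e * s + b := by
    zify
    rw [hy, ← hs]
    push_cast
    ring
  rw [hys, key s (by omega) a ha, key (L + 1) (by omega) a ha]

/-- If every coloring admits a monochromatic member of a homogeneous family, then it admits a member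
`B` together with a step `d` such that all `b + λ d` with `b ∈ B`, `|λ| ≤ M` have one color. -/
theorem exists_mono_progressions {κ : Type*} [Finite κ] {S : Set (Finset ℕ)}
    (hS : ∀ A ∈ S, A.Nonempty ∧ ∀ a ∈ A, 0 < a)
    (hhom : ∀ A ∈ S, ∀ k : ℕ, 0 < k → A.image (fun a => k * a) ∈ S)
    (hreg : ∀ c : ℕ → κ, ∃ A ∈ S, ∀ a ∈ A, ∀ b ∈ A, c a = c b) (M : ℕ) (c : ℕ → κ) :
    ∃ B ∈ S, ∃ d : ℕ, 0 < d ∧ ∃ γ, ∀ b ∈ B, M * d < b ∧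
      ∀ n : ℕ, ∀ l : ℤ, |l| ≤ M → (n : ℤ) = b + l * d → c n = γ := by
  obtain ⟨N, hN⟩ := exists_uniform_of_forall_coloring
    (fun N (c : ℕ → κ) => ∃ A ∈ S, (∀ a ∈ A, a ≤ N) ∧ ∀ a ∈ A, ∀ b ∈ A, c a = c b)
    (fun c N N' h ⟨A, hA, hAN, hc⟩ => ⟨A, hA, fun a ha => (hAN a ha).trans h, hc⟩)
    (fun N c c' h ⟨A, hA, hAN, hc⟩ => ⟨A, hA, hAN, fun a ha b hb => by
      rw [← h a (hAN a ha), ← h b (hAN b hb), hc a ha b hb]⟩)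
    (fun c => by
      obtain ⟨A, hA, hc⟩ := hreg c
      exact ⟨A.sup id, A, hA, fun a ha => Finset.le_sup (f := id) ha, hc⟩)
  obtain ⟨x, e, he, hx, hprog⟩ := exists_mono_dilated_progressions c N (M * N.factorial)
  obtain ⟨A, hA, hAN, hmono⟩ := hN fun j => c (j * x)
  obtain ⟨a₀, ha₀⟩ := (hS A hA).1
  have hx0 : 0 < x := by omega
  refine ⟨_, hhom A hA x hx0, e * N.factorial, Nat.mul_pos he N.factorial_pos,
    c (a₀ * x), ?_⟩
  simp only [Finset.forall_mem_image]
  intro a ha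
  have ha0 := (hS A hA).2 a ha
  refine ⟨by nlinarith, fun n l hl hn => ?_⟩
  obtain ⟨u, hu⟩ := Nat.dvd_factorial ha0 (hAN a ha)
  have hlu : |l * u| ≤ ((M * N.factorial : ℕ) : ℤ) := by
    rw [abs_mul, Nat.abs_cast]
    push_cast
    have : (u : ℤ) ≤ N.factorial := by
      rw [hu]
      exact_mod_cast Nat.le_mul_of_pos_left u ha0
    gcongr
  have hpos : 0 ≤ (x : ℤ) + l * u * e := by
    have h₁ := (abs_le.1 hlu).1
    zify at hx he
    push_cast at h₁
    nlinarith
  obtain ⟨y, hy⟩ := Int.eq_ofNat_of_zero_le hpos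
  have hny : n = a * y := by
    zify
    rw [hn, ← hy, hu]
    push_cast
    ring
  rw [hny, hprog a (hAN a ha) y (l * u) hlu hy.symm]
  exact hmono a ha a₀ ha₀

/-- Within `[1, N]`, the coloring `c` admits a set `B ∈ S` and a step `d` such that `q d` and all
`b + λ d` with `b ∈ B`, `|λ| ≤ M` have one color. -/
def HasMonoProgressions {κ : Type*} (S : Set (Finset ℕ)) (q M N : ℕ) (c : ℕ → κ) : Prop :=
  ∃ B ∈ S, ∃ d : ℕ, 0 < d ∧ q * d ≤ N ∧ ∀ b ∈ B, M * d < b ∧ b + M * d ≤ N ∧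
    ∀ n : ℕ, ∀ l : ℤ, |l| ≤ M → (n : ℤ) = b + l * d → c n = c (q * d)

namespace HasMonoProgressions

variable {κ : Type*} {S : Set (Finset ℕ)} {q M N N' : ℕ} {c c' : ℕ → κ}

theorem mono (h : N ≤ N') : HasMonoProgressions S q M N c → HasMonoProgressions S q M N' c :=
  fun ⟨B, hB, d, hd, hqd, H⟩ => ⟨B, hB, d, hd, hqd.trans h, fun b hb =>
    ⟨(H b hb).1, (H b hb).2.1.trans h, (H b hb).2.2⟩⟩

theorem congr (h : ∀ n ≤ N, c n = c' n) :
    HasMonoProgressions S q M N c → HasMonoProgressions S q M N c' := by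
  rintro ⟨B, hB, d, hd, hqd, H⟩
  refine ⟨B, hB, d, hd, hqd, fun b hb => ⟨(H b hb).1, (H b hb).2.1, fun n l hl hn => ?_⟩⟩
  have hnN : n ≤ N := by
    have h₁ := (H b hb).2.1
    have h₂ := (abs_le.1 hl).2
    zify at h₁ ⊢
    nlinarith
  rw [← h n hnN, ← h _ hqd, (H b hb).2.2 n l hl hn]

theorem of_dilate (hhom : ∀ A ∈ S, ∀ k : ℕ, 0 < k → A.image (fun a => k * a) ∈ S)
    {w : ℕ} (hw : 0 < w) :
    HasMonoProgressions S q M N (fun n => c (w * n)) → HasMonoProgressions S q M (w * N) c := by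
  rintro ⟨B, hB, d, hd, hqd, H⟩
  refine ⟨_, hhom B hB w hw, w * d, Nat.mul_pos hw hd, by nlinarith, ?_⟩
  simp only [Finset.forall_mem_image]
  intro b hb
  obtain ⟨h₁, h₂, h₃⟩ := H b hb
  refine ⟨by nlinarith, by nlinarith, fun n l hl hn => ?_⟩
  have hpos : 0 ≤ (b : ℤ) + l * d := by
    have := (abs_le.1 hl).1
    zify at h₁
    nlinarith
  obtain ⟨y, hy⟩ := Int.eq_ofNat_of_zero_le hpos
  have hny : n = w * y := by
    zify
    rw [hn, ← hy]
    push_cast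
    ring
  rw [hny, mul_left_comm q w d]
  exact h₃ y l hl hy.symm

/-- Uniformly in the coloring, either a color outside `K` is used on `[1, N]` or `[1, N]` contains
the required monochromatic progressions. -/
theorem exists_uniform_bound [Finite κ]
    (hS : ∀ A ∈ S, A.Nonempty ∧ ∀ a ∈ A, 0 < a)
    (hhom : ∀ A ∈ S, ∀ k : ℕ, 0 < k → A.image (fun a => k * a) ∈ S)
    (hreg : ∀ c : ℕ → κ, ∃ A ∈ S, ∀ a ∈ A, ∀ b ∈ A, c a = c b) (hq : 0 < q) (K : Finset κ) :
    ∃ N, ∀ c : ℕ → κ, (∃ n ≤ N, 0 < n ∧ c n ∉ K) ∨ HasMonoProgressions S q M N c := by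
  classical
  induction K using Finset.strongInduction with
  | H K ih =>
  refine exists_uniform_of_forall_coloring
    (fun N c => (∃ n ≤ N, 0 < n ∧ c n ∉ K) ∨ HasMonoProgressions S q M N c) ?_ ?_ ?_
  · exact fun c N N' h => Or.imp (fun ⟨n, hn, H⟩ => ⟨n, hn.trans h, H⟩) (mono h)
  · exact fun N c c' h => Or.imp (fun ⟨n, hn, h0, H⟩ => ⟨n, hn, h0, h n hn ▸ H⟩) (congr h)
  intro c
  obtain ⟨T, hT⟩ : ∃ T, ∀ γ ∈ K, ∀ c : ℕ → κ,
      (∃ n ≤ T, 0 < n ∧ c n ∉ K.erase γ) ∨ HasMonoProgressions S q M T c := by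
    choose! f hf using fun γ (hγ : γ ∈ K) => ih _ (Finset.erase_ssubset hγ)
    refine ⟨K.sup f, fun γ hγ c => ?_⟩
    have hle : f γ ≤ K.sup f := Finset.le_sup hγ
    exact (hf γ hγ c).imp (fun ⟨n, hn, H⟩ => ⟨n, hn.trans hle, H⟩) (mono hle)
  obtain ⟨B, hB, e, he, γ, H⟩ := exists_mono_progressions hS hhom hreg (M * T) c
  obtain ⟨b₀, hb₀⟩ := (hS B hB).1
  by_cases hγ : γ ∈ K
  swap
  · refine ⟨b₀, Or.inl ⟨b₀, le_rfl, (hS B hB).2 b₀ hb₀, ?_⟩⟩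
    rwa [(H b₀ hb₀).2 b₀ 0 (by simp; positivity) (by simp)]
  have hqe : 0 < q * e := Nat.mul_pos hq he
  rcases hT γ hγ fun n => c (q * e * n) with ⟨n, hnT, hn0, hn⟩ | h
  · by_cases hcK : c (q * e * n) ∈ K
    swap
    · exact ⟨_, Or.inl ⟨_, le_rfl, Nat.mul_pos hqe hn0, hcK⟩⟩
    have hcγ : c (q * e * n) = γ := by
      by_contra hne
      exact hn (Finset.mem_erase.2 ⟨hne, hcK⟩)
    refine ⟨q * (e * n) + (B.sup id + M * (e * n)), Or.inr
      ⟨B, hB, e * n, Nat.mul_pos he hn0, by omega, fun b hb => ⟨?_, ?_, fun m l hl hm => ?_⟩⟩⟩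
    · calc M * (e * n) = M * n * e := by ring
        _ ≤ M * T * e := by gcongr
        _ < b := (H b hb).1
    · have : b ≤ B.sup id := Finset.le_sup (f := id) hb
      omega
    · rw [← mul_assoc, hcγ]
      refine (H b hb).2 m (l * n) ?_ (by rw [hm]; push_cast; ring)
      rw [abs_mul, Nat.abs_cast]
      push_cast
      gcongr
  · exact ⟨_, Or.inr (of_dilate hhom hqe h)⟩

end HasMonoProgressions


/-- Corollary 2.2: as in Lemma 2.1, but with the bound `M` prescribed in advance,
and additionally `q·d` receives the same color. -/
theorem monochromatic_progressions_with_qd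
    (r : ℕ) (hr : 0 < r) (S : Set (Finset ℕ))
    (hS : ∀ A ∈ S, A.Nonempty ∧ ∀ a ∈ A, 0 < a)
    (hhom : ∀ A ∈ S, ∀ k : ℕ, 0 < k → A.image (fun a => k * a) ∈ S)
    (hreg : ∀ c : ℕ → Fin r, ∃ A ∈ S, ∀ a ∈ A, ∀ b ∈ A, c a = c b)
    (q M : ℕ) (hq : 0 < q) (hM : 0 < M)
    (c : ℕ → Fin r) :
    ∃ B ∈ S, ∃ d : ℕ, 0 < d ∧
      (∀ b ∈ B, ∀ lam : ℤ, |lam| ≤ (M : ℤ) → 0 < (b : ℤ) + lam * (d : ℤ)) ∧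
      (∀ b ∈ B, ∀ lam : ℤ, |lam| ≤ (M : ℤ) →
        ∀ b' ∈ B, ∀ lam' : ℤ, |lam'| ≤ (M : ℤ) →
          c ((b : ℤ) + lam * (d : ℤ)).toNat = c ((b' : ℤ) + lam' * (d : ℤ)).toNat) ∧
      (∀ b ∈ B, ∀ lam : ℤ, |lam| ≤ (M : ℤ) →
        c (q * d) = c ((b : ℤ) + lam * (d : ℤ)).toNat) := by
  obtain ⟨N, hN⟩ := HasMonoProgressions.exists_uniform_bound (M := M) hS hhom hreg hq Finset.univ
  obtain ⟨B, hB, d, hd, -, H⟩ := (hN c).resolve_left (by simp)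
  have hpos : ∀ b ∈ B, ∀ l : ℤ, |l| ≤ (M : ℤ) → 0 < (b : ℤ) + l * (d : ℤ) := by
    intro b hb l hl
    have h₁ := (H b hb).1
    have h₂ := (abs_le.1 hl).1
    zify at h₁
    nlinarith
  have hcol : ∀ b ∈ B, ∀ l : ℤ, |l| ≤ (M : ℤ) →
      c ((b : ℤ) + l * (d : ℤ)).toNat = c (q * d) := fun b hb l hl =>
    (H b hb).2.2 _ l hl (Int.toNat_of_nonneg (hpos b hb l hl).le)
  exact ⟨B, hB, d, hd, hpos,
    fun b hb l hl b' hb' l' hl' => (hcol b hb l hl).trans (hcol b' hb' l' hl').symm,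
    fun b hb l hl => (hcol b hb l hl).symm⟩
end

section
/- Suppose the linear homogeneous equation a₁x₁ + ⋯ + aₙxₙ = 0, with nonzero integer coefficients a₁, …, aₙ, is r-regular. Then for any positive integer k and any rational numbers b₁, …, b_k, the equation a₁x₁ + ⋯ + aₙxₙ + b₁x_{n+1} + ⋯ + b_k x_{n+k} = 0 is also r-regular: for every coloring of the positive integers with r colors there exist positive integers x₁, …, x_{n+k}, all of the same color, with a₁x₁ + ⋯ + aₙxₙ + b₁x_{n+1} + ⋯ + b_k x_{n+k} = 0 (the equation being interpreted over the rationals). -/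
/-- `c` admits a monochromatic positive solution of `∑ i, a i * x i + B * y = 0`. -/
def HasMonoSolution {r n : ℕ} (a : Fin n → ℤ) (B : ℚ) (c : ℕ → Fin r) : Prop :=
  ∃ x : Fin n → ℕ, ∃ y : ℕ, (∀ i, 0 < x i) ∧ 0 < y ∧ (∀ i, c (x i) = c y) ∧
    (∑ i, (a i : ℚ) * (x i : ℚ)) + B * (y : ℚ) = 0

/-- A monochromatic solution for a dilated coloring gives one for the coloring itself. -/
lemma HasMonoSolution.of_dilate {r n : ℕ} {a : Fin n → ℤ} {B : ℚ} {c : ℕ → Fin r} {d : ℕ}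
    (hd : 0 < d) (h : HasMonoSolution a B fun t => c (d * t)) : HasMonoSolution a B c := by
  obtain ⟨x, y, hx, hy, hc, hsum⟩ := h
  refine ⟨fun i => d * x i, d * y, fun i => Nat.mul_pos hd (hx i), Nat.mul_pos hd hy, hc, ?_⟩
  have hx' : ∑ i, (a i : ℚ) * ((d * x i : ℕ) : ℚ) = d * ∑ i, (a i : ℚ) * (x i : ℚ) := by
    rw [Finset.mul_sum]
    refine Finset.sum_congr rfl fun i _ => ?_
    push_cast
    ring
  rw [hx']
  push_cast
  linear_combination (d : ℚ) * hsum

/-- Compactness of the space of colorings: an increasing sequence of open sets of colorings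
which covers everything is eventually everything. -/
lemma exists_forall_mem_of_monotone_isOpen {r : ℕ} (U : ℕ → Set (ℕ → Fin r))
    (hU : ∀ N, IsOpen (U N)) (hmono : Monotone U) (hcov : ∀ c, ∃ N, c ∈ U N) :
    ∃ N, ∀ c, c ∈ U N := by
  obtain ⟨N, hN⟩ := isCompact_univ.elim_directed_cover U hU
    (fun c _ => Set.mem_iUnion.2 (hcov c)) hmono.directed_le
  exact ⟨N, fun c => hN (Set.mem_univ c)⟩

lemma isOpen_setOf_apply_eq_apply {r : ℕ} (s t : ℕ) :
    IsOpen {c : ℕ → Fin r | c s = c t} := by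
  simpa using (isOpen_discrete {p : Fin r × Fin r | p.1 = p.2}).preimage
    ((continuous_apply (A := fun _ : ℕ => Fin r) s).prodMk (continuous_apply t))

/-- Regularity of an equation is witnessed on a bounded interval. -/
lemma exists_bound_of_regular_s5 {r n : ℕ} (a : Fin n → ℤ)
    (hreg : ∀ c : ℕ → Fin r, ∃ x : Fin n → ℕ, (∀ i, 0 < x i) ∧
      (∀ i j, c (x i) = c (x j)) ∧ ∑ i, a i * (x i : ℤ) = 0) :
    ∃ N : ℕ, ∀ c : ℕ → Fin r, ∃ x : Fin n → ℕ, (∀ i, 0 < x i) ∧ (∀ i, x i ≤ N) ∧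
      (∀ i j, c (x i) = c (x j)) ∧ ∑ i, a i * (x i : ℤ) = 0 := by
  refine exists_forall_mem_of_monotone_isOpen
    (fun N => {c : ℕ → Fin r | ∃ x : Fin n → ℕ, (∀ i, 0 < x i) ∧ (∀ i, x i ≤ N) ∧
      (∀ i j, c (x i) = c (x j)) ∧ ∑ i, a i * (x i : ℤ) = 0}) ?_ ?_ ?_
  · intro N
    simp only [Set.ofPred_exists, Set.ofPred_and, Set.ofPred_forall]
    exact isOpen_iUnion fun x => (isOpen_iInter_of_finite fun _ => isOpen_const).inter <|
      (isOpen_iInter_of_finite fun _ => isOpen_const).inter <|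
      (isOpen_iInter_of_finite fun i => isOpen_iInter_of_finite fun j =>
        isOpen_setOf_apply_eq_apply (x i) (x j)).inter isOpen_const
  · rintro N N' hNN' c ⟨x, hx, hxN, h⟩
    exact ⟨x, hx, fun i => (hxN i).trans hNN', h⟩
  · intro c
    obtain ⟨x, hx, h⟩ := hreg c
    exact ⟨∑ i, x i, x, hx,
      fun i => Finset.single_le_sum (f := x) (fun _ _ => Nat.zero_le _) (Finset.mem_univ i), h⟩

/-- If every coloring with colors in `S` has a monochromatic solution, it suffices that the colors
of a long enough initial interval lie in `S`. -/
lemma exists_bound_of_forall_hasMonoSolution {r n : ℕ} (a : Fin n → ℤ) (B : ℚ) (S : Finset (Fin r))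
    (h : ∀ c : ℕ → Fin r, (∀ t, 0 < t → c t ∈ S) → HasMonoSolution a B c) :
    ∃ M : ℕ, ∀ c : ℕ → Fin r, (∀ t, 0 < t → t ≤ M → c t ∈ S) → HasMonoSolution a B c := by
  suffices hsuff : ∃ M, ∀ c : ℕ → Fin r,
      c ∈ {c : ℕ → Fin r | (∃ t, 0 < t ∧ t ≤ M ∧ c t ∉ S) ∨ HasMonoSolution a B c} by
    obtain ⟨M, hM⟩ := hsuff
    refine ⟨M, fun c hc => (hM c).resolve_left ?_⟩
    rintro ⟨t, ht, htM, hcS⟩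
    exact hcS (hc t ht htM)
  refine exists_forall_mem_of_monotone_isOpen
    (fun N => {c : ℕ → Fin r | (∃ t, 0 < t ∧ t ≤ N ∧ c t ∉ S) ∨ HasMonoSolution a B c}) ?_ ?_ ?_
  · intro N
    simp only [HasMonoSolution, Set.ofPred_or, Set.ofPred_exists, Set.ofPred_and, Set.ofPred_forall]
    refine IsOpen.union (isOpen_iUnion fun t => isOpen_const.inter <| isOpen_const.inter ?_)
      (isOpen_iUnion fun x => isOpen_iUnion fun y => IsOpen.inter ?_ <| isOpen_const.inter <|
        (isOpen_iInter_of_finite fun i => isOpen_setOf_apply_eq_apply (x i) y).inter isOpen_const)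
    · exact (isOpen_discrete {k : Fin r | k ∉ S}).preimage
        (continuous_apply (A := fun _ : ℕ => Fin r) t)
    · exact isOpen_iInter_of_finite fun i => isOpen_const
  · rintro N N' hNN' c (⟨t, ht, htN, hcS⟩ | hc)
    · exact Or.inl ⟨t, ht, htN.trans hNN', hcS⟩
    · exact Or.inr hc
  · intro c
    by_cases hc : ∀ t, 0 < t → c t ∈ S
    · exact ⟨0, Or.inr (h c hc)⟩
    · push Not at hc
      obtain ⟨t, ht, hcS⟩ := hc
      exact ⟨t, Or.inl ⟨t, ht, le_rfl, hcS⟩⟩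

/-- A van der Waerden theorem for simultaneous dilates: the progression is centered at `A`, and
all of its members are positive. -/
lemma exists_progression_dilates_mono {r : ℕ} (c : ℕ → Fin r) (N K : ℕ) :
    ∃ A D : ℕ, 0 < A ∧ 0 < D ∧ ∀ l : ℤ, |l| ≤ K → ∃ z : ℕ, 0 < z ∧ (z : ℤ) = A + l * D ∧
      ∀ j ≤ N, c (j * z) = c (j * A) := by
  obtain ⟨D, hD, e, χ, h⟩ := Combinatorics.exists_mono_homothetic_copy
    (Finset.Icc 1 (2 * K + 1)) (fun t => fun j : Fin (N + 1) => c (j * t))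
  have hcol : ∀ s ∈ Finset.Icc 1 (2 * K + 1), ∀ j, (hj : j ≤ N) →
      c (j * (D * s + e)) = χ ⟨j, Nat.lt_succ_of_le hj⟩ := fun s hs j hj =>
    congrFun (h s hs) ⟨j, Nat.lt_succ_of_le hj⟩
  refine ⟨D * (K + 1) + e, D, by positivity, hD, fun l hl => ?_⟩
  rw [abs_le] at hl
  obtain ⟨s, hs⟩ : ∃ s : ℕ, (s : ℤ) = K + 1 + l := ⟨(K + 1 + l).toNat, by omega⟩
  have hs0 : 0 < s := by omega
  refine ⟨D * s + e, by positivity, ?_, fun j hj => ?_⟩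
  · push_cast
    rw [hs]
    ring
  · rw [hcol s (Finset.mem_Icc.2 ⟨hs0, by omega⟩) j hj,
      hcol (K + 1) (Finset.mem_Icc.2 ⟨by omega, by omega⟩) j hj]

/-- Perturbing one coordinate of a solution along a monochromatic progression. -/
lemma hasMonoSolution_of_progression {r n : ℕ} {a : Fin n → ℤ} {B : ℚ} {c : ℕ → Fin r}
    {x : Fin n → ℕ} (hx : ∀ i, 0 < x i) (hsum : ∑ i, a i * (x i : ℤ) = 0) (i₀ : Fin n)
    {A D z y : ℕ} {l : ℤ} (hA : 0 < A) (hz : 0 < z) (hzA : (z : ℤ) = A + l * D) (hy : 0 < y)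
    (hxc : ∀ i, c (x i * A) = c y) (hzc : c (x i₀ * z) = c y)
    (heq : (a i₀ : ℚ) * x i₀ * l * D + B * y = 0) : HasMonoSolution a B c := by
  refine ⟨fun i => x i * if i = i₀ then z else A, y, fun i => ?_, hy, fun i => ?_, ?_⟩
  · refine Nat.mul_pos (hx i) ?_
    split_ifs <;> assumption
  · by_cases hi : i = i₀
    · subst hi
      simpa using hzc
    · simpa [hi] using hxc i
  · have hsumQ : ∑ i, (a i : ℚ) * (x i : ℚ) = 0 := by exact_mod_cast hsum
    have hzQ : (z : ℚ) = A + l * D := by exact_mod_cast hzA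
    have hterm : ∀ i, (a i : ℚ) * ((x i * if i = i₀ then z else A : ℕ) : ℚ) =
        a i * x i * A + if i = i₀ then (a i : ℚ) * x i * l * D else 0 := by
      intro i
      split_ifs
      · push_cast
        rw [hzQ]
        ring
      · push_cast
        ring
    simp only [hterm, Finset.sum_add_distrib, ← Finset.sum_mul, hsumQ]
    simpa using heq

/-- Adding one term to a regular equation: induction on the set of colors in use. -/
lemma hasMonoSolution_of_regular {r n : ℕ} (i₀ : Fin n) (a : Fin n → ℤ) (ha : a i₀ ≠ 0)
    (hreg : ∀ c : ℕ → Fin r, ∃ x : Fin n → ℕ, (∀ i, 0 < x i) ∧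
      (∀ i j, c (x i) = c (x j)) ∧ ∑ i, a i * (x i : ℤ) = 0) (B : ℚ) (S : Finset (Fin r)) :
    ∀ c : ℕ → Fin r, (∀ t, 0 < t → c t ∈ S) → HasMonoSolution a B c := by
  obtain ⟨N, hN⟩ := exists_bound_of_regular_s5 a hreg
  induction S using Finset.strongInduction with
  | H S ih =>
  intro c hcS
  have hbound : ∀ χ : Fin r, ∃ M : ℕ, χ ∈ S → ∀ c : ℕ → Fin r,
      (∀ t, 0 < t → t ≤ M → c t ∈ S.erase χ) → HasMonoSolution a B c := by
    intro χ
    by_cases hχ : χ ∈ S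
    · obtain ⟨M, hM⟩ := exists_bound_of_forall_hasMonoSolution a B (S.erase χ)
        (ih _ (Finset.erase_ssubset hχ))
      exact ⟨M, fun _ => hM⟩
    · exact ⟨0, fun h => absurd h hχ⟩
  choose M hM using hbound
  obtain ⟨A, D, hA, hD, hprog⟩ :=
    exists_progression_dilates_mono c N (B.num.natAbs * ∑ χ, M χ)
  obtain ⟨x, hx, hxN, hxc, hsum⟩ := hN fun t => c (t * A)
  have hχ : c (x i₀ * A) ∈ S := hcS _ (Nat.mul_pos (hx i₀) hA)
  have hd : 0 < B.den * (a i₀).natAbs * x i₀ * D :=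
    Nat.mul_pos (Nat.mul_pos (Nat.mul_pos B.den_pos (Int.natAbs_pos.2 ha)) (hx i₀)) hD
  by_cases hy : ∃ m, 0 < m ∧ m ≤ M (c (x i₀ * A)) ∧
      c (B.den * (a i₀).natAbs * x i₀ * D * m) = c (x i₀ * A)
  · obtain ⟨m, hm, hmM, hyc⟩ := hy
    have hmM' : m ≤ ∑ χ, M χ := hmM.trans
      (Finset.single_le_sum (f := M) (fun _ _ => Nat.zero_le _) (Finset.mem_univ _))
    have hl : |-((a i₀).sign * B.num * m)| ≤ ((B.num.natAbs * ∑ χ, M χ : ℕ) : ℤ) := by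
      rw [abs_neg, Int.abs_eq_natAbs, Int.natAbs_mul, Int.natAbs_mul, Int.natAbs_sign_of_ne_zero ha,
        one_mul, Int.natAbs_natCast]
      exact_mod_cast Nat.mul_le_mul_left _ hmM'
    obtain ⟨z, hz, hzA, hzc⟩ := hprog _ hl
    refine hasMonoSolution_of_progression hx hsum i₀ hA hz hzA (Nat.mul_pos hd hm)
      (fun i => (hxc i i₀).trans hyc.symm) ((hzc _ (hxN i₀)).trans hyc.symm) ?_
    have habs : (((a i₀).natAbs : ℕ) : ℚ) = (a i₀ : ℚ) * ((a i₀).sign : ℚ) := by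
      have h : (((a i₀).natAbs : ℕ) : ℤ) = a i₀ * (a i₀).sign := by
        rw [Int.mul_sign_self]
      rw [← Int.cast_natCast, h, Int.cast_mul]
    have hB : B * B.den = B.num := Rat.mul_den_eq_num B
    push_cast
    rw [habs]
    linear_combination ((a i₀ : ℚ) * ((a i₀).sign : ℚ) * x i₀ * D * m) * hB
  · push Not at hy
    exact (hM _ hχ _ fun t ht htM => Finset.mem_erase.2
      ⟨hy t ht htM, hcS _ (Nat.mul_pos hd ht)⟩).of_dilate hd

/-- Theorem 4.1: adding additional terms with rational coefficients to an
`r`-regular linear homogeneous equation keeps it `r`-regular. -/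
theorem add_terms_preserves_regularity
    (r : ℕ) (hr : 0 < r) (n : ℕ) (hn : 0 < n) (a : Fin n → ℤ) (ha : ∀ i, a i ≠ 0)
    (hreg : ∀ c : ℕ → Fin r, ∃ x : Fin n → ℕ, (∀ i, 0 < x i) ∧
      (∀ i j, c (x i) = c (x j)) ∧ ∑ i, a i * (x i : ℤ) = 0)
    (k : ℕ) (hk : 0 < k) (b : Fin k → ℚ) :
    ∀ c : ℕ → Fin r, ∃ x : Fin n → ℕ, ∃ y : Fin k → ℕ,
      (∀ i, 0 < x i) ∧ (∀ p, 0 < y p) ∧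
      (∀ i j, c (x i) = c (x j)) ∧ (∀ p q, c (y p) = c (y q)) ∧
      (∀ i p, c (x i) = c (y p)) ∧
      (∑ i, (a i : ℚ) * (x i : ℚ)) + (∑ p, b p * (y p : ℚ)) = 0 := by
  intro c
  obtain ⟨x, y, hx, hy, hc, hsum⟩ := hasMonoSolution_of_regular ⟨0, hn⟩ a (ha _) hreg (∑ p, b p)
    Finset.univ c fun _ _ => Finset.mem_univ _
  refine ⟨x, fun _ => y, hx, fun _ => hy, fun i j => (hc i).trans (hc j).symm, fun _ _ => rfl,
    fun i _ => hc i, ?_⟩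
  rwa [← Finset.sum_mul]
end

section
/- Let n ≥ 2 and let a₁, …, aₙ be nonzero integers. For every coloring c : ℕ⁺ → Fin (n−1) of the positive integers with n−1 colors, there exist positive integers x₁, …, xₙ, all receiving the same color under c, and a sign function f : {1, 2, …, n} → {−1, 1} with at most one index i satisfying f(i) = −1, such that f(1)·a₁·x₁ + f(2)·a₂·x₂ + ⋯ + f(n)·aₙ·xₙ = 0. -/
/-- Finitary van der Waerden theorem: in a finite coloring of `ℕ` there is a monochromatic
arithmetic progression of length `M + 1` whose terms and step lie below a bound depending only on
`M` and the set of colors. -/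
theorem exists_bound_mono_arithmetic_progression (κ : Type) [Finite κ] (M : ℕ) :
    ∃ T : ℕ, ∀ C : ℕ → κ, ∃ t e : ℕ, 0 < t ∧ 0 < e ∧ e ≤ T ∧ t + e * M ≤ T ∧
      ∀ s ≤ M, C (t + e * s) = C t := by
  classical
  obtain ⟨ι, hι, h⟩ := Combinatorics.Line.exists_mono_in_high_dimension (Fin (M + 1)) κ
  refine ⟨1 + Fintype.card ι * (M + 1), fun C => ?_⟩
  obtain ⟨l, k, hk⟩ := h fun v => C (1 + ∑ j, (v j : ℕ))
  set e := (Finset.univ.filter fun j => l.idxFun j = none).card with he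
  set t := 1 + ∑ j, (l 0 j : ℕ) with ht
  have key (s : Fin (M + 1)) : 1 + ∑ j, (l s j : ℕ) = t + e * s := by
    rw [ht, he, Finset.card_filter, Finset.sum_mul, add_assoc, ← Finset.sum_add_distrib]
    congr 1
    refine Finset.sum_congr rfl fun j _ => ?_
    cases hj : l.idxFun j <;> simp [Combinatorics.Line.coe_apply, hj]
  have hcol (s : ℕ) (hs : s ≤ M) : C (t + e * s) = k := by
    have := hk ⟨s, by omega⟩
    dsimp only at this
    rwa [key] at this
  have he_le : e ≤ Fintype.card ι := Finset.card_le_univ _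
  refine ⟨t, e, by omega, ?_, ?_, ?_, fun s hs => ?_⟩
  · obtain ⟨j, hj⟩ := l.proper
    exact Finset.card_pos.2 ⟨j, by simp [hj]⟩
  · nlinarith
  · have h1 := key (Fin.last M)
    have h2 : ∑ j, (l (Fin.last M) j : ℕ) ≤ Fintype.card ι * M := by
      simpa using Finset.sum_le_card_nsmul Finset.univ (fun j => (l (Fin.last M) j : ℕ)) M
        fun j _ => Fin.is_le _
    rw [Fin.val_last] at h1
    nlinarith
  · rw [hcol s hs]
    simpa using (hcol 0 (Nat.zero_le _)).symm

/-- The coloring `c` admits a monochromatic positive solution of `∑ aᵢ xᵢ = 0` after flipping the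
sign of at most one coefficient. -/
def HasMonoSolutionUpToFlip {n : ℕ} {κ : Type} (a : Fin n → ℤ) (c : ℕ → κ) : Prop :=
  ∃ x : Fin n → ℕ, ∃ f : Fin n → ℤ,
    (∀ i, 0 < x i) ∧
    (∀ i j, c (x i) = c (x j)) ∧
    (∀ i, f i = 1 ∨ f i = -1) ∧
    (∀ i j, f i = -1 → f j = -1 → i = j) ∧
    ∑ i, f i * a i * (x i : ℤ) = 0

/-- If `z p` and `z q` are inversely proportional to `|a p|` and `|a q|`, then monochromatic
progressions `d * z p * (t + e * s)` and `d * z q * (t + e * s)`, together with a multiple of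
`d * e * L` of the same color, yield a solution. -/
theorem hasMonoSolutionUpToFlip_of_mono_progressions {n : ℕ} {κ : Type} {a : Fin n → ℤ}
    {c : ℕ → κ} {p q : Fin n} (hpq : p ≠ q) {L : ℕ} {z : Fin n → ℕ} (hL : 0 < L)
    (hzp : |a p| * (z p : ℤ) = L) (hzq : |a q| * (z q : ℤ) = L) {d t e w M : ℕ} (hd : 0 < d)
    (ht : 0 < t) (he : 0 < e) (hw : 0 < w) (hM : (∑ i, |a i|) * w ≤ (M : ℤ)) {χ : κ}
    (hp : ∀ s ≤ M, c (d * z p * (t + e * s)) = χ)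
    (hq : ∀ s ≤ M, c (d * z q * (t + e * s)) = χ)
    (hχ : c (d * e * L * w) = χ) : HasMonoSolutionUpToFlip a c := by
  classical
  have hzp0 : 0 < z p := Nat.pos_of_ne_zero fun h => by simp [h] at hzp; omega
  have hzq0 : 0 < z q := Nat.pos_of_ne_zero fun h => by simp [h] at hzq; omega
  obtain ⟨σ, hσ, hσp⟩ : ∃ σ : ℤ, (σ = 1 ∨ σ = -1) ∧ a p = σ * |a p| := by
    rcases abs_choice (a p) with h | h
    · exact ⟨1, by simp, by omega⟩
    · exact ⟨-1, by simp, by omega⟩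
  obtain ⟨τ, hτ, hτq⟩ : ∃ τ : ℤ, (τ = 1 ∨ τ = -1) ∧ τ * a q = -σ * |a q| := by
    rcases hσ with rfl | rfl <;> rcases abs_choice (a q) with h | h
    · exact ⟨-1, by simp, by omega⟩
    · exact ⟨1, by simp, by omega⟩
    · exact ⟨1, by simp, by omega⟩
    · exact ⟨-1, by simp, by omega⟩
  set S := ∑ i ∈ (Finset.univ.erase p).erase q, a i with hS
  have hSle : |S| ≤ ∑ i, |a i| :=
    (Finset.abs_sum_le_sum_abs _ _).trans
      (Finset.sum_le_sum_of_subset_of_nonneg (Finset.subset_univ _) fun _ _ _ => abs_nonneg _)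
  have hD : |σ * S * w| ≤ M := by
    have hσ1 : |σ| = 1 := by rcases hσ with rfl | rfl <;> simp
    rw [abs_mul, abs_mul, hσ1, one_mul, Nat.abs_cast]
    exact (mul_le_mul_of_nonneg_right hSle (by positivity)).trans hM
  obtain ⟨s, u, hs, hu, hsu⟩ : ∃ s u : ℕ, s ≤ M ∧ u ≤ M ∧ (u : ℤ) - s = σ * S * w := by
    obtain ⟨h1, h2⟩ := abs_le.1 hD
    generalize σ * S * w = D at *
    exact ⟨(-D).toNat, D.toNat, by omega, by omega, by omega⟩
  set x : Fin n → ℕ := fun i =>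
    if i = q then d * z q * (t + e * u) else if i = p then d * z p * (t + e * s)
      else d * e * L * w with hx
  have hcx (i : Fin n) : c (x i) = χ := by
    simp only [hx]
    split_ifs
    exacts [hq u hu, hp s hs, hχ]
  refine ⟨x, fun i => if i = q then τ else 1, fun i => ?_, fun i j => by rw [hcx, hcx],
    fun i => ?_, fun i j hi hj => ?_, ?_⟩
  · simp only [hx]
    split_ifs <;> positivity
  · dsimp only
    split_ifs
    exacts [hτ, Or.inl rfl]
  · have aux (k : Fin n) (hk : (if k = q then τ else 1) = -1) : k = q := by
      by_contra h
      simp [h] at hk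
    rw [aux i hi, aux j hj]
  · rw [← Finset.add_sum_erase _ _ (Finset.mem_univ p),
      ← Finset.add_sum_erase _ _ (Finset.mem_erase.2 ⟨hpq.symm, Finset.mem_univ q⟩)]
    have hrest : ∑ i ∈ (Finset.univ.erase p).erase q,
        (if i = q then τ else 1) * a i * (x i : ℤ) = S * (d * e * L * w) := by
      rw [hS, Finset.sum_mul]
      refine Finset.sum_congr rfl fun i hi => ?_
      simp only [Finset.mem_erase] at hi
      simp [hx, hi.1, hi.2.1]
    rw [hrest]
    simp only [hx, if_neg hpq, if_true]
    push_cast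
    have hσσ : σ * σ = 1 := by rcases hσ with rfl | rfl <;> rfl
    have h1 : a p * (z p : ℤ) = σ * L := by rw [hσp, mul_assoc, hzp]
    have h2 : τ * a q * (z q : ℤ) = -σ * L := by rw [hτq, mul_assoc, hzq]
    linear_combination (d * (t + e * s) : ℤ) * h1 + (d * (t + e * u) : ℤ) * h2
      - (σ * L * d * e : ℤ) * hsu - (S * w * L * d * e : ℤ) * hσσ

/-- If the multiples `d * m` with `0 < m ≤ N` use at most `r` colors, where `N` is large in terms of `r`, then
there is a monochromatic solution. -/
theorem exists_bound_hasMonoSolutionUpToFlip {n : ℕ} {κ : Type} [Fintype κ] [DecidableEq κ]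
    (hκ : Fintype.card κ < n) (a : Fin n → ℤ) (ha : ∀ i, a i ≠ 0) (c : ℕ → κ) (r : ℕ) :
    ∃ N : ℕ, ∀ (C : Finset κ) (d : ℕ), C.card = r → 0 < d →
      (∀ m, 0 < m → m ≤ N → c (d * m) ∈ C) → HasMonoSolutionUpToFlip a c := by
  induction r with
  | zero =>
    refine ⟨1, fun C d hC _ h => ?_⟩
    rw [Finset.card_eq_zero] at hC
    simpa [hC] using h 1 one_pos le_rfl
  | succ r ih =>
    obtain ⟨N, hN⟩ := ih
    set L := ∏ i, (a i).natAbs with hL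
    have hL0 : 0 < L := Finset.prod_pos fun i _ => Int.natAbs_pos.2 (ha i)
    have hdvd (i : Fin n) : (a i).natAbs ∣ L := Finset.dvd_prod_of_mem _ (Finset.mem_univ i)
    choose z hz using hdvd
    have hzL (i : Fin n) : |a i| * (z i : ℤ) = L := by
      rw [Int.abs_eq_natAbs]
      exact_mod_cast (hz i).symm
    have hz0 (i : Fin n) : 0 < z i := Nat.pos_of_ne_zero fun h => by
      have := hz i
      simp [h] at this
      omega
    have hz_le (i : Fin n) : z i ≤ L := by
      rw [hz i]
      exact Nat.le_mul_of_pos_left _ (Int.natAbs_pos.2 (ha i))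
    set M := (∑ i, (a i).natAbs) * N with hM
    obtain ⟨T, hT⟩ := exists_bound_mono_arithmetic_progression (Fin n → κ) M
    refine ⟨L * T * (N + 1), fun C d hC hd h => ?_⟩
    obtain ⟨t, e, ht, he, heT, htT, hmono⟩ := hT fun m i => c (d * z i * m)
    obtain ⟨p, q, hpq, hcol⟩ := Fintype.exists_ne_map_eq_of_card_lt
      (fun i : Fin n => c (d * z i * t)) (by simpa using hκ)
    have hmono' (i : Fin n) (s : ℕ) (hs : s ≤ M) : c (d * z i * (t + e * s)) = c (d * z i * t) :=
      congrFun (hmono s hs) i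
    by_cases hw : ∃ w, 0 < w ∧ w ≤ N ∧ c (d * e * L * w) = c (d * z p * t)
    · obtain ⟨w, hw0, hwN, hw⟩ := hw
      refine hasMonoSolutionUpToFlip_of_mono_progressions (M := M) hpq hL0 (hzL p) (hzL q)
        hd ht he hw0 ?_ (hmono' p) (fun s hs => (hmono' q s hs).trans hcol.symm) hw
      simp only [Int.abs_eq_natAbs]
      exact_mod_cast Nat.mul_le_mul_left _ hwN
    · push Not at hw
      have hmem : c (d * z p * t) ∈ C := by
        rw [mul_assoc]
        refine h _ (Nat.mul_pos (hz0 p) ht) ?_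
        calc z p * t ≤ L * T := Nat.mul_le_mul (hz_le p) (by omega)
          _ ≤ L * T * (N + 1) := Nat.le_mul_of_pos_right _ N.succ_pos
      refine hN (C.erase (c (d * z p * t))) (d * e * L)
        (by rw [Finset.card_erase_of_mem hmem, hC]; rfl) (by positivity)
        fun m hm hmN => Finset.mem_erase.2 ⟨hw m hm hmN, ?_⟩
      have := h (e * L * m) (by positivity) <| by
        rw [mul_comm e L]
        exact Nat.mul_le_mul (Nat.mul_le_mul_left _ heT) (by omega)
      simpa only [mul_assoc] using this

/-- Theorem 4.2: for any equation `∑ aᵢ xᵢ = 0` with nonzero integer coefficients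
and any `(n-1)`-coloring, there is a monochromatic positive tuple satisfying the
equation after flipping the sign of at most one coefficient. -/
theorem monochromatic_solution_after_one_sign_flip
    (n : ℕ) (hn : 2 ≤ n) (a : Fin n → ℤ) (ha : ∀ i, a i ≠ 0)
    (c : ℕ → Fin (n - 1)) :
    ∃ x : Fin n → ℕ, ∃ f : Fin n → ℤ,
      (∀ i, 0 < x i) ∧
      (∀ i j, c (x i) = c (x j)) ∧
      (∀ i, f i = 1 ∨ f i = -1) ∧
      (∀ i j, f i = -1 → f j = -1 → i = j) ∧
      ∑ i, f i * a i * (x i : ℤ) = 0 := by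
  obtain ⟨N, hN⟩ := exists_bound_hasMonoSolutionUpToFlip
    (by simpa using (by omega : n - 1 < n)) a ha c (n - 1)
  exact hN Finset.univ 1 (by simp) one_pos fun _ _ _ => Finset.mem_univ _
end
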